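/- For nonnegative integers a, b with a ≥ 1, every graph G with mad(G) < (4/3)a + b is (1_1,...,1_a,0_1,...,0_b)-colorable: V(G) can be partitioned into b independent sets and a sets each inducing a subgraph of maximum degree at most 1. -/

import Mathlib

/-- The maximum average degree of a finite graph `G`: the supremum over all nonempty
vertex subsets `S` of `2|E(G[S])|/|S|`. -/
noncomputable def mad {V : Type*} [Fintype V] (G : SimpleGraph V) [DecidableRel G.Adj] : ℝ :=
  sSup {x : ℝ | ∃ S : Finset V, S.Nonempty ∧
    x = (((S ×ˢ S).filter fun p => G.Adj p.1 p.2).card : ℝ) / S.card}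

/-- `G` is `(1_1,…,1_a,0_1,…,0_b)`-colorable: `a + b` colors, the first `a` classes induce
subgraphs of maximum degree at most `1`, the last `b` classes are independent sets. -/
def DColorable {V : Type*} (G : SimpleGraph V) (a b : ℕ) : Prop :=
  ∃ f : V → Fin (a + b),
    (∀ v, (f v : ℕ) < a → {w | G.Adj v w ∧ f w = f v}.Subsingleton) ∧
    (∀ v, a ≤ (f v : ℕ) → ∀ w, G.Adj v w → f w ≠ f v)

/-- `x u v` is the share of the weight `T` of the edge `uv` that is assigned to `u`. -/
structure IsWeightSplit {V : Type*} (G : SimpleGraph V) (T : ℤ) (x : V → V → ℤ) : Prop where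
  nonneg : ∀ u v, 0 ≤ x u v
  add_eq : ∀ u v, G.Adj u v → x u v + x v u = T
  eq_zero : ∀ u v, ¬ G.Adj u v → x u v = 0

section Shift

variable {V : Type*} [DecidableEq V]

/-- Move one unit of weight of the edge `sw` from `s` to `w`. -/
def shiftUnit (x : V → V → ℤ) (s w : V) : V → V → ℤ := fun a b =>
  x a b - (if a = s ∧ b = w then 1 else 0) + (if a = w ∧ b = s then 1 else 0)

theorem IsWeightSplit.shift {G : SimpleGraph V} {T : ℤ} {x : V → V → ℤ}
    (hx : IsWeightSplit G T x) {s w : V} (h : 0 < x s w) :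
    IsWeightSplit G T (shiftUnit x s w) := by
  have hsw : G.Adj s w := by
    by_contra hn
    have := hx.eq_zero _ _ hn
    omega
  refine ⟨fun u v => ?_, fun u v huv => ?_, fun u v huv => ?_⟩
  · have := hx.nonneg u v
    unfold shiftUnit
    split_ifs with h1 h2 <;> first | omega | skip
    obtain ⟨rfl, rfl⟩ := h1
    omega
  · have := hx.add_eq u v huv
    unfold shiftUnit
    grind
  · have := hx.eq_zero u v huv
    have h1 : ¬ (u = s ∧ v = w) := by rintro ⟨rfl, rfl⟩; exact huv hsw
    have h2 : ¬ (u = w ∧ v = s) := by rintro ⟨rfl, rfl⟩; exact huv hsw.symm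
    simp [shiftUnit, h1, h2, this]

theorem sum_shiftUnit [Fintype V] (x : V → V → ℤ) (s w a : V) :
    ∑ b, shiftUnit x s w a b =
      ∑ b, x a b - (if a = s then 1 else 0) + (if a = w then 1 else 0) := by
  simp only [shiftUnit, Finset.sum_add_distrib, Finset.sum_sub_distrib, ite_and]
  congr 1
  · congr 1
    split_ifs <;> simp
  · split_ifs <;> simp

theorem shiftUnit_le_max {G : SimpleGraph V} {T θ : ℤ} {x : V → V → ℤ}
    (hx : IsWeightSplit G T x) {s w : V} (hθ : 0 ≤ θ) (h : θ < x s w) (a b : V) :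
    shiftUnit x s w a b ≤ max (x a b) (T - θ) := by
  have hsw : G.Adj s w := by
    by_contra hn
    have := hx.eq_zero _ _ hn
    omega
  have := hx.add_eq _ _ hsw
  unfold shiftUnit
  split_ifs with h1 h2 h2
  · omega
  · omega
  · obtain ⟨rfl, rfl⟩ := h2
    omega
  · omega

theorem isChain_shiftUnit {θ : ℤ} {x : V → V → ℤ} (s : V) {w : V} {l : List V}
    (hl : List.IsChain (fun u v => θ < x u v) (w :: l)) (hw : w ∉ l) :
    List.IsChain (fun u v => θ < shiftUnit x s w u v) (w :: l) := by
  have key : ∀ (l : List V) (c : V), List.IsChain (fun u v => θ < x u v) (c :: l) → w ∉ l →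
      List.IsChain (fun u v => θ < shiftUnit x s w u v) (c :: l) := by
    intro l
    induction l with
    | nil => intro c _ _; exact List.isChain_singleton _
    | cons d l ih =>
      intro c hc hw
      rw [List.isChain_cons_cons] at hc ⊢
      refine ⟨?_, ih d hc.2 (by simp_all)⟩
      have hd : d ≠ w := by rintro rfl; simp at hw
      have := hc.1
      simp only [shiftUnit, hd, and_false, if_false]
      split_ifs <;> omega
  exact key l w hl hw

theorem exists_nodup_isChain_of_reflTransGen {r : V → V → Prop} {s t : V}
    (h : Relation.ReflTransGen r s t) :
    ∃ l : List V, List.IsChain r (s :: l) ∧ (s :: l).Nodup ∧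
      (s :: l).getLast (List.cons_ne_nil _ _) = t := by
  induction h using Relation.ReflTransGen.head_induction_on with
  | refl => exact ⟨[], by simp⟩
  | @head a c hac _ ih =>
    obtain ⟨l, hl, hnd, hlast⟩ := ih
    by_cases ha : a ∈ c :: l
    · obtain ⟨l₁, l₂, hsplit⟩ := List.append_of_mem ha
      have hsuf : (a :: l₂) <:+ (c :: l) := ⟨l₁, hsplit.symm⟩
      refine ⟨l₂, hl.suffix hsuf, hnd.sublist hsuf.sublist, ?_⟩
      rw [← hlast]
      simp [hsplit]
    · exact ⟨c :: l, List.isChain_cons_cons.2 ⟨hac, hl⟩, List.nodup_cons.2 ⟨ha, hnd⟩, by simpa⟩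

theorem IsWeightSplit.exists_push [Fintype V] {G : SimpleGraph V} {T θ : ℤ} (hθ : 0 ≤ θ)
    (l : List V) : ∀ (s : V) (x : V → V → ℤ), IsWeightSplit G T x →
    List.IsChain (fun u v => θ < x u v) (s :: l) → l.Nodup →
    ∃ y, IsWeightSplit G T y ∧
      (∀ a, ∑ b, y a b = ∑ b, x a b - (if a = s then 1 else 0) +
        (if a = (s :: l).getLast (List.cons_ne_nil _ _) then 1 else 0)) ∧
      ∀ a b, y a b ≤ max (x a b) (T - θ) := by
  induction l with
  | nil => exact fun s x hx _ _ => ⟨x, hx, fun a => (sub_add_cancel _ _).symm, by simp⟩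
  | cons w l ih =>
    intro s x hx hc hnd
    rw [List.isChain_cons_cons] at hc
    rw [List.nodup_cons] at hnd
    obtain ⟨y, hy, hload, hle⟩ := ih w _ (hx.shift (by omega))
      (isChain_shiftUnit s hc.2 hnd.1) hnd.2
    refine ⟨y, hy, fun a => ?_, fun a b => ?_⟩
    · rw [hload, sum_shiftUnit, List.getLast_cons (List.cons_ne_nil _ _)]
      ring
    · have := hle a b
      have := shiftUnit_le_max hx hθ hc.1 a b
      omega

theorem IsWeightSplit.exists_no_heavy_cycle [Fintype V] {G : SimpleGraph V} {T θ : ℤ}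
    (hθ : 0 ≤ θ) (hT : 2 * θ ≤ T) {x : V → V → ℤ} (hx : IsWeightSplit G T x) :
    ∃ y, IsWeightSplit G T y ∧ (∀ a, ∑ b, y a b = ∑ b, x a b) ∧
      ∀ v s, T - θ < y v s → ¬ Relation.ReflTransGen (fun u w => θ < y u w) s v := by
  let P : Set (V → V → ℤ) := {y | IsWeightSplit G T y ∧ ∀ a, ∑ b, y a b = ∑ b, x a b}
  let Φ : (V → V → ℤ) → ℕ := fun y => ∑ a, ∑ b, (y a b - (T - θ)).toNat
  obtain ⟨y, hyP, hmin⟩ := WellFounded.has_min (measure Φ).wf P ⟨x, hx, fun _ => rfl⟩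
  refine ⟨y, hyP.1, hyP.2, fun v s hvs hpath => ?_⟩
  obtain ⟨l, hl, hnd, hlast⟩ := exists_nodup_isChain_of_reflTransGen hpath
  rw [List.nodup_cons] at hnd
  obtain ⟨z, hz, hload, hle⟩ := IsWeightSplit.exists_push hθ l s _
    (hyP.1.shift (s := v) (w := s) (by omega)) (isChain_shiftUnit v hl hnd.1) hnd.2
  refine hmin z ⟨hz, fun a => ?_⟩ ?_
  · rw [hload, sum_shiftUnit, hlast, ← hyP.2]
    ring
  · have hsh := shiftUnit_le_max hyP.1 hθ (show θ < y v s by omega)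
    have hle' : ∀ a b, (z a b - (T - θ)).toNat ≤ (y a b - (T - θ)).toNat := by
      intro a b
      have := hle a b
      have := hsh a b
      omega
    have hne : v ≠ s := by
      rintro rfl
      have := hyP.1.eq_zero v v (G.loopless.irrefl v)
      omega
    have hlt : (z v s - (T - θ)).toNat < (y v s - (T - θ)).toNat := by
      have := hle v s
      have h1 : shiftUnit y v s v s = y v s - 1 := by simp [shiftUnit, hne]
      omega
    change Φ z < Φ y
    exact Finset.sum_lt_sum (fun a _ => Finset.sum_le_sum fun b _ => hle' a b)
      ⟨v, Finset.mem_univ _, Finset.sum_lt_sum (fun b _ => hle' v b) ⟨s, Finset.mem_univ _, hlt⟩⟩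

end Shift

theorem exists_isWeightSplit_sum_le {V : Type*} [Fintype V] (G : SimpleGraph V)
    [DecidableRel G.Adj] {M L : ℤ} (hM : 0 ≤ M)
    (h : ∀ S : Finset V, S.Nonempty →
      M * ((S ×ˢ S).filter fun p => G.Adj p.1 p.2).card ≤ L * S.card) :
    ∃ x, IsWeightSplit G (2 * M) x ∧ ∀ a, ∑ b, x a b ≤ L := by
  classical
  let P : Set (V → V → ℤ) := {y | IsWeightSplit G (2 * M) y}
  let Φ : (V → V → ℤ) → ℕ := fun y => ∑ a, (∑ b, y a b - L).toNat
  have hP : P.Nonempty := by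
    refine ⟨fun u v => if G.Adj u v then M else 0, fun u v => ?_, fun u v huv => ?_,
      fun u v huv => ?_⟩
    · split_ifs <;> omega
    · simp [huv, huv.symm]; ring
    · simp [huv]
  obtain ⟨y, hy, hmin⟩ := WellFounded.has_min (measure Φ).wf P hP
  replace hy : IsWeightSplit G (2 * M) y := hy
  refine ⟨y, hy, fun s => ?_⟩
  by_contra! hs
  let W : Finset V := Finset.univ.filter fun t =>
    Relation.ReflTransGen (fun u w => 0 < y u w) s t
  have hsW : s ∈ W := by simp [W, Relation.ReflTransGen.refl]
  have hge : ∀ t ∈ W, L ≤ ∑ b, y t b := by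
    intro t ht
    by_contra! hlt
    obtain ⟨l, hl, hnd, hlast⟩ := exists_nodup_isChain_of_reflTransGen (Finset.mem_filter.1 ht).2
    obtain ⟨z, hz, hload, -⟩ := IsWeightSplit.exists_push le_rfl l s y hy hl
      (List.nodup_cons.1 hnd).2
    refine hmin z hz ?_
    change Φ z < Φ y
    have hst : s ≠ t := by rintro rfl; omega
    refine Finset.sum_lt_sum (fun a _ => ?_) ⟨s, Finset.mem_univ _, ?_⟩
    · rw [hload, hlast]
      by_cases hat : a = t
      · subst hat
        split_ifs <;> omega
      · split_ifs <;> omega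
    · rw [hload, hlast]
      simp only [if_true, hst, if_false]
      omega
  have hlt : L * W.card < ∑ t ∈ W, ∑ b, y t b := by
    have := Finset.sum_lt_sum (s := W) (f := fun _ => L) hge ⟨s, hsW, hs⟩
    simpa [mul_comm] using this
  have hin : ∑ t ∈ W, ∑ b, y t b = ∑ t ∈ W, ∑ b ∈ W, y t b := by
    refine Finset.sum_congr rfl fun t ht => ?_
    refine (Finset.sum_subset (Finset.subset_univ W) fun b _ hb => ?_).symm
    by_contra hne
    refine hb (Finset.mem_filter.2 ⟨Finset.mem_univ _, (Finset.mem_filter.1 ht).2.tail ?_⟩)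
    have := hy.nonneg t b
    omega
  have hdouble : 2 * ∑ t ∈ W, ∑ b ∈ W, y t b =
      2 * (M * ((W ×ˢ W).filter fun p => G.Adj p.1 p.2).card) := by
    calc 2 * ∑ t ∈ W, ∑ b ∈ W, y t b = ∑ t ∈ W, ∑ b ∈ W, (y t b + y b t) := by
          simp only [Finset.sum_add_distrib]
          rw [Finset.sum_comm (f := fun t b => y b t)]
          ring
      _ = ∑ p ∈ W ×ˢ W, if G.Adj p.1 p.2 then 2 * M else 0 := by
          rw [Finset.sum_product]
          refine Finset.sum_congr rfl fun t _ => Finset.sum_congr rfl fun b _ => ?_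
          split_ifs with htb
          · exact hy.add_eq t b htb
          · rw [hy.eq_zero t b htb, hy.eq_zero b t fun h => htb h.symm, add_zero]
      _ = _ := by
          rw [← Finset.sum_filter, Finset.sum_const, nsmul_eq_mul]
          ring
  have := h W ⟨s, hsW⟩
  omega

/-- Every finite vertex set contains a `k`-dominating subset inducing maximum degree below `k`. -/
theorem exists_dependent_dominating_subset {V : Type*} [DecidableEq V] (G : SimpleGraph V)
    [DecidableRel G.Adj] {k : ℕ} (C : Finset V) :
    ∃ S ⊆ C, (∀ v ∈ S, (S.filter (G.Adj v)).card < k) ∧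
      ∀ v ∈ C \ S, k ≤ (S.filter (G.Adj v)).card := by
  let f : Finset V → ℤ := fun S =>
    (2 * k - 1) * S.card - ∑ v ∈ S, ((S.filter (G.Adj v)).card : ℤ)
  have hins : ∀ (S : Finset V) (v : V), v ∉ S →
      f (insert v S) = f S + (2 * k - 1) - 2 * ((S.filter (G.Adj v)).card : ℤ) := by
    intro S v hv
    have h1 : ∀ u ∈ S, (((insert v S).filter (G.Adj u)).card : ℤ) =
        (S.filter (G.Adj u)).card + if G.Adj v u then 1 else 0 := by
      intro u _
      rw [Finset.filter_insert]
      by_cases h : G.Adj u v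
      · simp [h, h.symm, hv]
      · simp [h, G.adj_comm v u]
    simp only [f]
    rw [Finset.sum_insert hv, Finset.sum_congr rfl h1, Finset.sum_add_distrib,
      Finset.card_insert_of_notMem hv, Finset.filter_insert]
    simp
    ring
  obtain ⟨S, hS, hmax⟩ := Finset.exists_max_image C.powerset f ⟨∅, by simp⟩
  rw [Finset.mem_powerset] at hS
  refine ⟨S, hS, fun v hv => ?_, fun v hv => ?_⟩
  · have h1 := hins (S.erase v) v (Finset.notMem_erase v S)
    have h2 := hmax (S.erase v) (Finset.mem_powerset.2 ((Finset.erase_subset _ _).trans hS))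
    rw [Finset.insert_erase hv] at h1
    have h3 : (S.erase v).filter (G.Adj v) = S.filter (G.Adj v) := by
      ext u
      simp only [Finset.mem_filter, Finset.mem_erase]
      exact ⟨fun h => ⟨h.1.2, h.2⟩, fun h => ⟨⟨h.2.ne', h.1⟩, h.2⟩⟩
    rw [h3] at h1
    omega
  · rw [Finset.mem_sdiff] at hv
    have h1 := hins S v hv.2
    have h2 := hmax (insert v S) (Finset.mem_powerset.2 (Finset.insert_subset hv.1 hS))
    omega

theorem IsWeightSplit.exists_terminal_subset {V : Type*} [DecidableEq V] {T θ : ℤ}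
    {x : V → V → ℤ}
    (hcyc : ∀ v s, T - θ < x v s → ¬ Relation.ReflTransGen (fun u w => θ < x u w) s v)
    {R : Finset V} (hR : R.Nonempty) :
    ∃ C ⊆ R, C.Nonempty ∧ (∀ v ∈ C, ∀ u ∈ R \ C, x v u ≤ θ) ∧
      ∀ v ∈ C, ∀ u ∈ C, x v u ≤ T - θ := by
  classical
  obtain ⟨C, hC, hmin⟩ := Finset.exists_min_image
    (R.powerset.filter fun C => C.Nonempty ∧ ∀ v ∈ C, ∀ u ∈ R \ C, x v u ≤ θ) Finset.card
    ⟨R, by simpa [hR] using fun _ _ _ hu hn => absurd hu hn⟩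
  simp only [Finset.mem_filter, Finset.mem_powerset] at hC hmin
  obtain ⟨hCR, hne, hcl⟩ := hC
  refine ⟨C, hCR, hne, hcl, fun v hv s hs => ?_⟩
  by_contra! hlt
  let D := C.filter fun t => Relation.ReflTransGen (fun u w => θ < x u w) s t
  have hDC : D ⊆ C := Finset.filter_subset _ _
  have hcard := hmin D ⟨hDC.trans hCR, ⟨s, Finset.mem_filter.2 ⟨hs, .refl⟩⟩, fun a ha u hu => by
    rw [Finset.mem_sdiff] at hu
    by_contra! hau
    have haC := Finset.mem_filter.1 ha
    by_cases huC : u ∈ C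
    · exact hu.2 (Finset.mem_filter.2 ⟨huC, haC.2.tail hau⟩)
    · exact hau.not_ge (hcl a haC.1 u (Finset.mem_sdiff.2 ⟨hu.1, huC⟩))⟩
  have hDeq := Finset.eq_of_subset_of_card_le hDC hcard
  rw [← hDeq] at hv
  exact hcyc v s hlt (Finset.mem_filter.1 hv).2

theorem IsWeightSplit.exists_dependent_subset {V : Type*} [DecidableEq V] {G : SimpleGraph V}
    [DecidableRel G.Adj] {k : ℕ} {θ : ℤ} (hθ : 0 ≤ θ) {x : V → V → ℤ}
    (hx : IsWeightSplit G ((k + 1) * θ) x)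
    (hcyc : ∀ v s, (k + 1) * θ - θ < x v s →
      ¬ Relation.ReflTransGen (fun u w => θ < x u w) s v) (R : Finset V) :
    ∃ S ⊆ R, (∀ v ∈ S, (S.filter (G.Adj v)).card < k) ∧
      ∀ v ∈ R \ S, k * θ ≤ ∑ s ∈ S, x v s := by
  induction R using Finset.strongInduction with
  | H R ih =>
  rcases R.eq_empty_or_nonempty with rfl | hR
  · exact ⟨∅, by simp⟩
  obtain ⟨C, hCR, hCne, hout, hin⟩ := IsWeightSplit.exists_terminal_subset hcyc hR
  obtain ⟨A, hAC, hAdeg, hAdom⟩ := exists_dependent_dominating_subset G (k := k) C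
  let R' := (R \ C).filter fun v => ∀ s ∈ A, ¬ G.Adj v s
  have hR' : R' ⊂ R := by
    obtain ⟨c, hc⟩ := hCne
    refine Finset.ssubset_iff_subset_ne.2
      ⟨(Finset.filter_subset _ _).trans Finset.sdiff_subset, fun h => ?_⟩
    have : c ∈ R' := h ▸ hCR hc
    simp [R', hc] at this
  obtain ⟨B, hBR, hBdeg, hBdom⟩ := ih R' hR'
  have hAB : ∀ s ∈ A, ∀ t ∈ B, ¬ G.Adj s t := fun s hs t ht hst =>
    (Finset.mem_filter.1 (hBR ht)).2 s hs hst.symm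
  have hsum : ∀ (v : V) (D : Finset V), D ⊆ A ∪ B → ∑ s ∈ D, x v s ≤ ∑ s ∈ A ∪ B, x v s :=
    fun v D hD => Finset.sum_le_sum_of_subset_of_nonneg hD fun s _ _ => hx.nonneg v s
  refine ⟨A ∪ B, Finset.union_subset (hAC.trans hCR) (hBR.trans hR'.1), fun v hv => ?_,
    fun v hv => ?_⟩
  · rw [Finset.filter_union]
    rcases Finset.mem_union.1 hv with hv | hv
    · rw [Finset.filter_false_of_mem (hAB v hv), Finset.union_empty]
      exact hAdeg v hv
    · rw [Finset.filter_false_of_mem fun s hs h => hAB s hs v hv h.symm, Finset.empty_union]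
      exact hBdeg v hv
  · simp only [Finset.mem_sdiff, Finset.mem_union, not_or] at hv
    obtain ⟨hvR, hvA, hvB⟩ := hv
    by_cases hvC : v ∈ C
    · have h1 := hAdom v (Finset.mem_sdiff.2 ⟨hvC, hvA⟩)
      refine le_trans ?_ (hsum v (A.filter (G.Adj v))
        ((Finset.filter_subset _ _).trans Finset.subset_union_left))
      have h2 := Finset.card_nsmul_le_sum (A.filter (G.Adj v)) (x v) θ fun s hs => by
        rw [Finset.mem_filter] at hs
        have := hx.add_eq v s hs.2
        have := hin s (hAC hs.1) v hvC
        linarith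
      rw [nsmul_eq_mul] at h2
      refine le_trans ?_ h2
      gcongr
    · by_cases hvN : ∃ s ∈ A, G.Adj v s
      · obtain ⟨s, hs, hvs⟩ := hvN
        refine le_trans ?_ (hsum v {s} (by simp [hs]))
        rw [Finset.sum_singleton]
        have := hx.add_eq v s hvs
        have := hout s (hAC hs) v (Finset.mem_sdiff.2 ⟨hvR, hvC⟩)
        linarith
      · push Not at hvN
        exact (hBdom v (Finset.mem_sdiff.2 ⟨by simp [R', hvR, hvC]; exact hvN, hvB⟩)).trans
          (hsum v B Finset.subset_union_right)

/-- Deleting a suitable set inducing maximum degree below `k` lowers all loads by `k * θ`. -/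
theorem IsWeightSplit.exists_dependent_set_sum_le {V : Type*} [Fintype V] [DecidableEq V]
    {G : SimpleGraph V} [DecidableRel G.Adj] {k : ℕ} (hk : 1 ≤ k) {T θ L : ℤ} (hθ : 0 ≤ θ)
    (hT : (k + 1) * θ = T) {x : V → V → ℤ} (hx : IsWeightSplit G T x)
    (hL : ∀ a, ∑ b, x a b ≤ L) :
    ∃ S : Finset V, (∀ v ∈ S, (S.filter (G.Adj v)).card < k) ∧
      ∃ y, IsWeightSplit (G.comap (Subtype.val : {v // v ∉ S} → V)) T y ∧
        ∀ a, ∑ b, y a b ≤ L - k * θ := by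
  subst hT
  have hk' : (1 : ℤ) ≤ k := by exact_mod_cast hk
  obtain ⟨y, hy, hload, hcyc⟩ := hx.exists_no_heavy_cycle hθ (by nlinarith)
  obtain ⟨S, -, hdeg, hdom⟩ := hy.exists_dependent_subset hθ hcyc Finset.univ
  refine ⟨S, hdeg, fun a b => y a b, ⟨fun u v => hy.nonneg u v,
    fun u v huv => hy.add_eq u v huv, fun u v huv => hy.eq_zero u v huv⟩, fun a => ?_⟩
  have h1 := hdom a (by simpa using a.2)
  have h2 : ∑ b ∈ Sᶜ, y a b = ∑ b : {v // v ∉ S}, y a b :=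
    Finset.sum_subtype Sᶜ (fun _ => Finset.mem_compl) (y a)
  have h3 := Finset.sum_add_sum_compl S (y a)
  have h4 := hL a
  rw [← hload] at h4
  linarith

/-- Extend a colouring of `G - S` by giving all of `S` one new last colour. -/
def colorWithLast {V : Type*} [DecidableEq V] {n : ℕ} (S : Finset V)
    (f : {v // v ∉ S} → Fin n) (v : V) : Fin (n + 1) :=
  if h : v ∈ S then Fin.last n else (f ⟨v, h⟩).castSucc

section ColorWithLast

variable {V : Type*} [DecidableEq V] {n : ℕ} {S : Finset V} {f : {v // v ∉ S} → Fin n} {v w : V}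

theorem colorWithLast_of_mem (h : v ∈ S) : colorWithLast S f v = Fin.last n := by
  simp [colorWithLast, h]

theorem colorWithLast_of_notMem (h : v ∉ S) :
    colorWithLast S f v = (f ⟨v, h⟩).castSucc := by
  simp [colorWithLast, h]

theorem colorWithLast_eq_iff_of_mem (h : v ∈ S) :
    colorWithLast S f w = colorWithLast S f v ↔ w ∈ S := by
  by_cases hw : w ∈ S
  · simp [colorWithLast_of_mem, h, hw]
  · simp [colorWithLast_of_mem h, colorWithLast_of_notMem hw, hw, Fin.castSucc_ne_last]

theorem colorWithLast_eq_iff_of_notMem (h : v ∉ S) :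
    colorWithLast S f w = colorWithLast S f v ↔ ∃ hw : w ∉ S, f ⟨w, hw⟩ = f ⟨v, h⟩ := by
  by_cases hw : w ∈ S
  · simp [colorWithLast_of_mem hw, colorWithLast_of_notMem h, hw, (Fin.castSucc_ne_last _).symm]
  · simp [colorWithLast_of_notMem hw, colorWithLast_of_notMem h, hw]

end ColorWithLast

theorem dColorable_succ_zero {V : Type*} [DecidableEq V] {G : SimpleGraph V}
    [DecidableRel G.Adj] {a : ℕ} {S : Finset V}
    (hS : ∀ v ∈ S, (S.filter (G.Adj v)).card < 2)
    (h : DColorable (G.comap (Subtype.val : {v // v ∉ S} → V)) a 0) :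
    DColorable G (a + 1) 0 := by
  obtain ⟨f, hf, -⟩ := h
  refine ⟨colorWithLast S f, fun v _ => ?_, fun v hv => ?_⟩
  · by_cases hvS : v ∈ S
    · simp only [colorWithLast_eq_iff_of_mem hvS]
      intro u hu w hw
      exact Finset.card_le_one.1 (Nat.le_of_lt_succ (hS v hvS)) u
        (Finset.mem_filter.2 hu.symm) w (Finset.mem_filter.2 hw.symm)
    · simp only [colorWithLast_eq_iff_of_notMem hvS]
      rintro u ⟨hu, huS, hfu⟩ w ⟨hw, hwS, hfw⟩
      exact congrArg Subtype.val (hf ⟨v, hvS⟩ (f ⟨v, hvS⟩).isLt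
        (show (⟨u, huS⟩ : {v // v ∉ S}) ∈ _ from ⟨hu, hfu⟩)
        (show (⟨w, hwS⟩ : {v // v ∉ S}) ∈ _ from ⟨hw, hfw⟩))
  · exact absurd (colorWithLast S f v).isLt (by omega)

theorem dColorable_succ_right {V : Type*} [DecidableEq V] {G : SimpleGraph V}
    [DecidableRel G.Adj] {a b : ℕ} {S : Finset V}
    (hS : ∀ v ∈ S, (S.filter (G.Adj v)).card < 1)
    (h : DColorable (G.comap (Subtype.val : {v // v ∉ S} → V)) a b) :
    DColorable G a (b + 1) := by
  obtain ⟨f, hf, hf'⟩ := h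
  refine ⟨colorWithLast S f, fun v hv => ?_, fun v hv w hvw => ?_⟩
  · by_cases hvS : v ∈ S
    · rw [colorWithLast_of_mem hvS, Fin.val_last] at hv
      exact absurd hv (Nat.le_add_right a b).not_gt
    · rw [colorWithLast_of_notMem hvS] at hv
      simp only [colorWithLast_eq_iff_of_notMem hvS]
      rintro u ⟨hu, huS, hfu⟩ w ⟨hw, hwS, hfw⟩
      exact congrArg Subtype.val (hf ⟨v, hvS⟩ hv
        (show (⟨u, huS⟩ : {v // v ∉ S}) ∈ _ from ⟨hu, hfu⟩)
        (show (⟨w, hwS⟩ : {v // v ∉ S}) ∈ _ from ⟨hw, hfw⟩))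
  · by_cases hvS : v ∈ S
    · rw [Ne, colorWithLast_eq_iff_of_mem hvS]
      intro hwS
      have := hS v hvS
      rw [Nat.lt_one_iff, Finset.card_eq_zero, Finset.filter_eq_empty_iff] at this
      exact this hwS hvw
    · rw [colorWithLast_of_notMem hvS] at hv
      rw [Ne, colorWithLast_eq_iff_of_notMem hvS]
      rintro ⟨hwS, hfw⟩
      exact hf' ⟨v, hvS⟩ hv ⟨w, hwS⟩ hvw hfw

theorem IsWeightSplit.dColorable {M : ℤ} (hM : 0 ≤ M) (a b : ℕ) :
    ∀ {V : Type*} [Fintype V] (G : SimpleGraph V) (L : ℤ) (x : V → V → ℤ),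
      IsWeightSplit G (6 * M) x → (∀ v, ∑ w, x v w ≤ L) → L < M * (4 * a + 3 * b) →
      DColorable G a b := by
  classical
  induction b with
  | zero =>
    induction a with
    | zero =>
      intro V _ G L x hx hload hL
      have : IsEmpty V := ⟨fun v => by
        have := hload v
        have := Finset.sum_nonneg fun w (_ : w ∈ Finset.univ) => hx.nonneg v w
        simp at hL
        omega⟩
      exact ⟨isEmptyElim, isEmptyElim, isEmptyElim⟩
    | succ a ih =>
      intro V _ G L x hx hload hL
      obtain ⟨S, hS, y, hy, hyload⟩ := hx.exists_dependent_set_sum_le (k := 2) (θ := 2 * M)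
        (by norm_num) (by omega) (by push_cast; ring) hload
      refine dColorable_succ_zero hS (ih _ _ y hy hyload ?_)
      push_cast at hL ⊢
      linarith
  | succ b ih =>
    intro V _ G L x hx hload hL
    obtain ⟨S, hS, y, hy, hyload⟩ := hx.exists_dependent_set_sum_le (k := 1) (θ := 3 * M)
      le_rfl (by omega) (by push_cast; ring) hload
    refine dColorable_succ_right hS (ih _ _ y hy hyload ?_)
    push_cast at hL ⊢
    linarith

theorem card_div_le_mad {V : Type*} [Fintype V] (G : SimpleGraph V) [DecidableRel G.Adj]
    {S : Finset V} (hS : S.Nonempty) :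
    (((S ×ˢ S).filter fun p => G.Adj p.1 p.2).card : ℝ) / S.card ≤ mad G := by
  refine le_csSup (Set.Finite.bddAbove ?_) ⟨S, hS, rfl⟩
  refine (Set.finite_range fun S : Finset V =>
    (((S ×ˢ S).filter fun p => G.Adj p.1 p.2).card : ℝ) / S.card).subset ?_
  rintro _ ⟨S, -, rfl⟩
  exact ⟨S, rfl⟩

/-- Main theorem: for `a ≥ 1`, every graph `G` with `mad(G) < (4/3)a + b` is
`(1_1,…,1_a,0_1,…,0_b)`-colorable. -/
theorem stmt8 {V : Type*} [Fintype V] (G : SimpleGraph V) [DecidableRel G.Adj]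
    (a b : ℕ) (ha : 1 ≤ a)
    (hmad : mad G < 4 * (a : ℝ) / 3 + b) :
    DColorable G a b := by
  obtain ⟨M, hM⟩ : ∃ M : ℤ, M = Fintype.card V + 1 := ⟨_, rfl⟩
  have hM0 : 0 ≤ M := by omega
  obtain ⟨x, hx, hload⟩ := exists_isWeightSplit_sum_le G (M := 3 * M)
    (L := M * (4 * a + 3 * b) - 1) (by omega) fun S hS => by
      have h1 := (card_div_le_mad G hS).trans_lt hmad
      rw [div_lt_iff₀ (by exact_mod_cast hS.card_pos)] at h1
      have h2 : (3 * ((S ×ˢ S).filter fun p => G.Adj p.1 p.2).card : ℤ) <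
          (4 * a + 3 * b) * S.card := by
        have : (3 * ((S ×ˢ S).filter fun p => G.Adj p.1 p.2).card : ℝ) <
            (4 * a + 3 * b) * S.card := by linarith
        exact_mod_cast this
      have h3 : (S.card : ℤ) ≤ M := by
        have := S.card_le_univ
        omega
      have h4 := mul_le_mul_of_nonneg_left (Int.add_one_le_of_lt h2) hM0
      linarith
  rw [show 2 * (3 * M) = 6 * M by ring] at hx
  exact IsWeightSplit.dColorable hM0 a b G _ x hx hload (by omega)
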